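/- arXiv:1708.03550 — 2 statements merged into one kernel-verified Lean document; each statement's English description precedes it below -/
import Mathlib

section
/- Every finite nearly nilpotent group is strongly supersoluble. -/
open Subgroup Pointwise

variable {G : Type*} [Group G]

/-- A subgroup `M` of `G` is modular if it is a modular element of the lattice of
subgroups of `G`. -/
def IsModularSubgroup (M : Subgroup G) : Prop :=
  (∀ X Z : Subgroup G, X ≤ Z → X ⊔ (M ⊓ Z) = (X ⊔ M) ⊓ Z) ∧
  (∀ Y Z : Subgroup G, M ≤ Z → M ⊔ (Y ⊓ Z) = (M ⊔ Y) ⊓ Z)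

/-- A subgroup `H` of `G` is S-quasinormal if `HP = PH` for every Sylow subgroup `P` of `G`. -/
def IsSQuasinormal (H : Subgroup G) : Prop :=
  ∀ (p : ℕ), p.Prime → ∀ P : Sylow p G,
    (H : Set G) * ((P : Subgroup G) : Set G) = ((P : Subgroup G) : Set G) * (H : Set G)

/-- `H` is a maximal subgroup of `K` (both being subgroups of the ambient group `G`). -/
def IsMaximalIn (K H : Subgroup G) : Prop :=
  H < K ∧ ∀ L : Subgroup G, H < L → L ≤ K → L = K

/-- `H` is an `n`-maximal subgroup of `G`: there is a chain
`H = M_n < … < M_1 < M_0 = G` with `M_i` maximal in `M_{i-1}` for all `i`. -/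
def IsNMaximal (n : ℕ) (H : Subgroup G) : Prop :=
  ∃ M : Fin (n + 1) → Subgroup G,
    M 0 = ⊤ ∧ M (Fin.last n) = H ∧
    ∀ i : Fin n, IsMaximalIn (M i.castSucc) (M i.succ)

/-- A group is supersoluble if it has a normal series with cyclic factors. -/
def IsSupersoluble (G : Type*) [Group G] : Prop :=
  ∃ (n : ℕ) (s : Fin (n + 1) → Subgroup G) (_hnorm : ∀ i, (s i).Normal),
    s 0 = ⊥ ∧ s (Fin.last n) = ⊤ ∧
    ∀ i : Fin n, s i.castSucc ≤ s i.succ ∧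
      haveI := _hnorm i.castSucc
      IsCyclic ↥((s i.succ).map (QuotientGroup.mk' (s i.castSucc)))

/-- `H/K` is a chief factor of `G`: both are normal in `G`, `K < H`, and there is no
normal subgroup of `G` strictly between `K` and `H` (i.e. `H/K` is a minimal normal
subgroup of `G/K`). -/
def IsChiefFactor (H K : Subgroup G) : Prop :=
  K.Normal ∧ H.Normal ∧ K < H ∧
    ∀ N : Subgroup G, N.Normal → K < N → N ≤ H → N = H

/-- The centralizer `C_G(H/K)` of a factor `H/K`: the preimage in `G` of the
centralizer of `HK/K` in `G/K`. -/
def chiefCentralizer (H K : Subgroup G) (hK : K.Normal) : Subgroup G :=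
  haveI := hK
  Subgroup.comap (QuotientGroup.mk' K)
    (Subgroup.centralizer ((H.map (QuotientGroup.mk' K) : Subgroup (G ⧸ K)) : Set (G ⧸ K)))

/-- The factor `H/K` is non-Frattini, i.e. `HK/K ≰ Φ(G/K)`. -/
def IsNonFrattini (H K : Subgroup G) (hK : K.Normal) : Prop :=
  haveI := hK
  ¬ H.map (QuotientGroup.mk' K) ≤ frattini (G ⧸ K)

/-- A group is strongly supersoluble if it is supersoluble and the automorphism group
`G/C_G(H/K)` induced by `G` on any chief factor `H/K` has square-free order. -/
def IsStronglySupersoluble (G : Type*) [Group G] : Prop :=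
  IsSupersoluble G ∧
    ∀ H K : Subgroup G, ∀ hc : IsChiefFactor H K,
      Squarefree (chiefCentralizer H K hc.1).index

/-- A group is nearly nilpotent if it is supersoluble and the automorphism group
`G/C_G(H/K)` induced by `G` on any non-Frattini chief factor `H/K` has order dividing
a prime. -/
def IsNearlyNilpotent (G : Type*) [Group G] : Prop :=
  IsSupersoluble G ∧
    ∀ H K : Subgroup G, ∀ hc : IsChiefFactor H K, IsNonFrattini H K hc.1 →
      ∃ p : ℕ, p.Prime ∧ (chiefCentralizer H K hc.1).index ∣ p

/-- The strongly supersoluble residual `G^{U_s}`: the intersection of all normal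
subgroups `N` of `G` with `G/N` strongly supersoluble. -/
def ssResidual (G : Type*) [Group G] : Subgroup G :=
  sInf {N : Subgroup G | ∃ _hN : N.Normal,
    haveI := _hN
    IsStronglySupersoluble (G ⧸ N)}

open scoped commutatorElement

theorem mem_chiefCentralizer_iff {H K : Subgroup G} (hK : K.Normal) {g : G} :
    g ∈ chiefCentralizer H K hK ↔ ∀ h ∈ H, ⁅h, g⁆ ∈ K := by
  simp only [chiefCentralizer, mem_comap, mem_centralizer_iff, coe_map, Set.forall_mem_image,
    SetLike.mem_coe]
  refine forall₂_congr fun h _ => ?_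
  rw [← commutatorElement_eq_one_iff_mul_comm, ← map_commutatorElement]
  exact QuotientGroup.eq_one_iff _

theorem chiefCentralizer_normal {H K : Subgroup G} (hK : K.Normal) (hH : H.Normal) :
    (chiefCentralizer H K hK).Normal := by
  unfold chiefCentralizer
  have := hH.map (QuotientGroup.mk' K) (QuotientGroup.mk'_surjective K)
  infer_instance

theorem IsChiefFactor.eq_or_eq {H K N : Subgroup G} (hc : IsChiefFactor H K) (hN : N.Normal)
    (hKN : K ≤ N) (hNH : N ≤ H) : N = K ∨ N = H := by
  rcases hKN.eq_or_lt with h | h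
  · exact Or.inl h.symm
  · exact Or.inr (hc.2.2.2 N hN h hNH)

/-- Chief factors of a supersoluble group are cyclic. -/
theorem IsSupersoluble.isCyclic_chiefFactor (hG : IsSupersoluble G) {H K : Subgroup G}
    [K.Normal] (hc : IsChiefFactor H K) : IsCyclic (H.map (QuotientGroup.mk' K)) := by
  obtain ⟨n, s, hs, h0, hlast, hstep⟩ := hG
  have := hc.2.1
  have := hs
  have hor (j : Fin (n + 1)) : (H ⊓ s j) ⊔ K = K ∨ (H ⊓ s j) ⊔ K = H :=
    hc.eq_or_eq inferInstance le_sup_right (sup_le inf_le_left hc.2.2.1.le)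
  obtain ⟨i, hi, hi'⟩ : ∃ i : Fin n, (H ⊓ s i.castSucc) ⊔ K = K ∧ (H ⊓ s i.succ) ⊔ K = H := by
    by_contra! hcon
    have hall (j : Fin (n + 1)) : (H ⊓ s j) ⊔ K = K := by
      induction j using Fin.induction with
      | zero => simp [h0]
      | succ i ih => exact (hor i.succ).resolve_right (hcon i ih)
    have := hall (Fin.last n)
    rw [hlast, inf_top_eq, sup_eq_right] at this
    exact hc.2.2.1.not_ge this
  have := (hstep i).2
  have hT : IsCyclic ((H ⊓ s i.succ).map (QuotientGroup.mk' (s i.castSucc))) :=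
    isCyclic_of_le (map_mono inf_le_right)
  obtain ⟨⟨_, t, ht, rfl⟩, hgen⟩ := hT
  refine ⟨⟨QuotientGroup.mk' K t, mem_map_of_mem _ ht.1⟩, ?_⟩
  rintro ⟨_, h, hh, rfl⟩
  rw [SetLike.mem_coe, ← hi', mem_sup_of_normal_right] at hh
  obtain ⟨x, hx, k, hk, rfl⟩ := hh
  obtain ⟨m, hm⟩ := mem_zpowers_iff.mp (hgen ⟨_, mem_map_of_mem _ hx⟩)
  refine mem_zpowers_iff.mpr ⟨m, Subtype.ext ?_⟩
  have hm' : ((t ^ m : G) : G ⧸ s i.castSucc) = x := congrArg Subtype.val hm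
  have hmem : (t ^ m)⁻¹ * x ∈ K :=
    (sup_eq_right.mp hi) ⟨H.mul_mem (H.inv_mem (H.zpow_mem ht.1 m)) hx.1, QuotientGroup.eq.mp hm'⟩
  change ((t ^ m : G) : G ⧸ K) = ((x * k : G) : G ⧸ K)
  rw [QuotientGroup.eq, ← mul_assoc]
  exact K.mul_mem hmem hk

/-- Chief factors of a finite supersoluble group have prime order. -/
theorem IsSupersoluble.prime_card_chiefFactor [Finite G] (hG : IsSupersoluble G)
    {H K : Subgroup G} [K.Normal] (hc : IsChiefFactor H K) :
    (Nat.card (H.map (QuotientGroup.mk' K))).Prime := by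
  have := hc.2.1
  have hcyc := hG.isCyclic_chiefFactor hc
  set N := H.map (QuotientGroup.mk' K) with hN
  have hcomm : ∀ a b : N, a * b = b * a := fun a b => mul_comm' a b
  have hne : Nat.card N ≠ 1 := fun h1 => by
    rw [card_eq_one, hN, Subgroup.map_eq_bot_iff, QuotientGroup.ker_mk'] at h1
    exact hc.2.2.1.not_ge h1
  obtain ⟨p, hp, hpN⟩ := Nat.exists_prime_and_dvd hne
  have := Fact.mk hp
  have hmk (h : G) (hh : h ∈ H) : QuotientGroup.mk' K h ∈ N := mem_map_of_mem _ hh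
  let T : Subgroup G :=
    { carrier := {x | x ∈ H ∧ (QuotientGroup.mk' K x) ^ p = 1}
      one_mem' := ⟨H.one_mem, by simp⟩
      mul_mem' := by
        rintro a b ⟨ha, ha'⟩ ⟨hb, hb'⟩
        have hab : Commute (QuotientGroup.mk' K a) (QuotientGroup.mk' K b) :=
          congrArg Subtype.val (hcomm ⟨_, hmk a ha⟩ ⟨_, hmk b hb⟩)
        refine ⟨H.mul_mem ha hb, ?_⟩
        rw [map_mul, hab.mul_pow, ha', hb', one_mul]
      inv_mem' := by
        rintro a ⟨ha, ha'⟩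
        exact ⟨H.inv_mem ha, by rw [map_inv, inv_pow, ha', inv_one]⟩ }
  have hT : T.Normal := ⟨by
    rintro a ⟨ha, ha'⟩ g
    refine ⟨hc.2.1.conj_mem a ha g, ?_⟩
    rw [map_mul, map_mul, map_inv, conj_pow, ha', mul_one, mul_inv_cancel]⟩
  have hKT : K ≤ T := fun k hk =>
    ⟨hc.2.2.1.le hk, by
      rw [show QuotientGroup.mk' K k = 1 from (QuotientGroup.eq_one_iff k).mpr hk, one_pow]⟩
  have hTH : T = H := by
    refine (hc.eq_or_eq hT hKT fun x hx => hx.1).resolve_left fun hTK => ?_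
    obtain ⟨⟨_, x, hx, rfl⟩, hxp⟩ := exists_prime_orderOf_dvd_card' p hpN
    have hpow := pow_orderOf_eq_one (⟨_, hmk x hx⟩ : N)
    rw [hxp] at hpow
    have hxT : x ∈ T := ⟨hx, congrArg Subtype.val hpow⟩
    rw [hTK] at hxT
    have h1 : (⟨_, hmk x hx⟩ : N) = 1 := Subtype.ext ((QuotientGroup.eq_one_iff x).mpr hxT)
    rw [h1, orderOf_one] at hxp
    exact hp.one_lt.ne hxp
  have hexp : Nat.card N ∣ p := by
    rw [← IsCyclic.exponent_eq_card, Monoid.exponent_dvd_iff_forall_pow_eq_one]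
    rintro ⟨_, x, hx, rfl⟩
    rw [SetLike.mem_coe, ← hTH] at hx
    exact Subtype.ext hx.2
  rwa [((Nat.dvd_prime hp).mp hexp).resolve_left hne]

/-- A nilpotent normal subgroup centralizes every chief factor. -/
theorem IsChiefFactor.le_chiefCentralizer {H K D : Subgroup G} (hc : IsChiefFactor H K)
    [D.Normal] [Group.IsNilpotent D] : D ≤ chiefCentralizer H K hc.1 := by
  have := hc.1
  have := hc.2.1
  rcases hc.eq_or_eq (N := ⁅H, D⁆ ⊔ K) inferInstance le_sup_right
    (sup_le (commutator_le_left H D) hc.2.2.1.le) with h | h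
  · intro d hd
    rw [mem_chiefCentralizer_iff]
    exact fun x hx => (sup_eq_right.mp h) (commutator_mem_commutator hx hd)
  · have hle (n : ℕ) : H ≤ D.lowerCentralSeries n ⊔ K := by
      induction n with
      | zero =>
        calc H = ⁅H, D⁆ ⊔ K := h.symm
          _ ≤ D ⊔ K := sup_le_sup_right (commutator_le_right H D) K
      | succ n ih =>
        rw [← h]
        refine sup_le (commutator_le.mpr fun x hx d hd => ?_) le_sup_right
        obtain ⟨y, hy, k, hk, rfl⟩ := mem_sup_of_normal_right.mp (ih hx)
        rw [commutatorElement_mul_left_eq_conj_mul]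
        have hkd : ⁅k, d⁆ ∈ K := commutator_le_left K D (commutator_mem_commutator hk hd)
        exact mul_mem (mem_sup_right (hc.1.conj_mem _ hkd y))
          (mem_sup_left (commutator_mem_commutator hy hd))
    obtain ⟨n, hn⟩ := (isNilpotent_iff_lowerCentralSeries D).mp inferInstance
    have := hle n
    rw [hn, bot_sup_eq] at this
    exact absurd this hc.2.2.1.not_ge

theorem IsCoatom.map_mk' {M L : Subgroup G} [L.Normal] (hM : IsCoatom M) (hL : L ≤ M) :
    IsCoatom (M.map (QuotientGroup.mk' L)) := by
  have hcomap : (M.map (QuotientGroup.mk' L)).comap (QuotientGroup.mk' L) = M :=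
    comap_map_eq_self (by rwa [QuotientGroup.ker_mk'])
  refine ⟨fun h => hM.1 ?_, fun S hS => ?_⟩
  · rw [← hcomap, h, comap_top]
  · apply comap_injective (QuotientGroup.mk'_surjective L)
    rw [comap_top]
    refine hM.2 _ ?_
    conv_lhs => rw [← hcomap]
    exact (comap_lt_comap_of_surjective (QuotientGroup.mk'_surjective L)).mpr hS

theorem exists_isChiefFactor [Finite G] {L : Subgroup G} (hL : L.Normal) (hne : L ≠ ⊤) :
    ∃ A, IsChiefFactor A L := by
  obtain ⟨A, hA⟩ := (Set.toFinite {A : Subgroup G | A.Normal ∧ L < A}).exists_minimal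
    ⟨⊤, inferInstance, hne.lt_top⟩
  exact ⟨A, hL, hA.prop.1, hA.prop.2, fun S hS hLS hSA =>
    le_antisymm hSA (hA.le_of_le ⟨hS, hLS⟩ hSA)⟩

/-- In a finite group, a maximal subgroup meets every subgroup that centralizes all non-Frattini
chief factors inside its normal core. -/
theorem inf_le_normalCore_of_le_chiefCentralizer [Finite G] {D M : Subgroup G}
    (hM : IsCoatom M)
    (hD : ∀ H K : Subgroup G, ∀ hc : IsChiefFactor H K, IsNonFrattini H K hc.1 →
      D ≤ chiefCentralizer H K hc.1) : D ⊓ M ≤ M.normalCore := by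
  set L := M.normalCore
  have hLM : L ≤ M := normalCore_le M
  obtain ⟨A, hc⟩ := exists_isChiefFactor (normalCore_normal M) (ne_top_of_le_ne_top hM.1 hLM)
  have := hc.2.1
  have hAM : ¬ A ≤ M := fun h => hc.2.2.1.not_ge (normal_le_normalCore.mpr h)
  have hnF : IsNonFrattini A L hc.1 := fun h => by
    have := h.trans (frattini_le_coatom (hM.map_mk' hLM))
    rw [map_le_iff_le_comap, comap_map_eq_self (by rwa [QuotientGroup.ker_mk'])] at this
    exact hAM this
  have htop : M ⊔ A = ⊤ := hM.2 _ (lt_of_le_of_ne le_sup_left fun h => hAM (sup_eq_left.mp h.symm))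
  have hDC := hD A L hc hnF
  have hnorm : (chiefCentralizer A L hc.1 ⊓ M).Normal := by
    have hCn := chiefCentralizer_normal hc.1 hc.2.1
    rw [← normalizer_eq_top_iff, eq_top_iff, ← htop]
    have hAnorm : A ≤ normalizer ((chiefCentralizer A L hc.1 ⊓ M : Subgroup G) : Set G) := by
      rw [le_normalizer_iff_commutator_le_right, commutator_le]
      rintro a ha c ⟨hcC, hcM⟩
      have hac : ⁅a, c⁆ ∈ L := mem_chiefCentralizer_iff hc.1 |>.mp hcC a ha
      exact ⟨commutator_le_right ⊤ _ (commutator_mem_commutator (mem_top a) hcC), hLM hac⟩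
    have hMnorm : M ≤ normalizer ((chiefCentralizer A L hc.1 ⊓ M : Subgroup G) : Set G) := by
      rw [le_normalizer_iff_commutator_le_right, commutator_le]
      rintro a ha c ⟨hcC, hcM⟩
      exact ⟨commutator_le_right ⊤ _ (commutator_mem_commutator (mem_top a) hcC),
        M.mul_mem (M.mul_mem (M.mul_mem ha hcM) (M.inv_mem ha)) (M.inv_mem hcM)⟩
    exact sup_le hMnorm hAnorm
  exact (inf_le_inf_right M hDC).trans (normal_le_normalCore.mpr inf_le_right)

/-- In a finite group, a normal subgroup that centralizes all non-Frattini chief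
factors is nilpotent. -/
theorem isNilpotent_of_le_chiefCentralizer [Finite G] {D : Subgroup G} [D.Normal]
    (hD : ∀ H K : Subgroup G, ∀ hc : IsChiefFactor H K, IsNonFrattini H K hc.1 →
      D ≤ chiefCentralizer H K hc.1) : Group.IsNilpotent D := by
  have htfae := (Group.isNilpotent_of_finite_tfae (G := D)).out 0 3
  rw [htfae]
  intro p hp P
  have hfrat := Sylow.normalizer_sup_eq_top P
  suffices h : normalizer ((P.map D.subtype : Subgroup G) : Set G) = ⊤ by
    rw [normalizer_eq_top_iff] at h
    have := h.comap D.subtype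
    rwa [comap_map_eq_self_of_injective D.subtype_injective] at this
  by_contra hne
  obtain ⟨M, hM, hNM⟩ := (eq_top_or_exists_le_coatom _).resolve_left hne
  have hDM : ¬ D ≤ M := fun h => hM.1 (top_unique (hfrat ▸ sup_le hNM h))
  have hPM : P.map D.subtype ≤ M := le_normalizer.trans hNM
  have hPL : P.map D.subtype ≤ D ⊓ M.normalCore :=
    le_inf (map_subtype_le _)
      ((le_inf (map_subtype_le _) hPM).trans (inf_le_normalCore_of_le_chiefCentralizer hM hD))
  have hPE : (P : Subgroup D) ≤ M.normalCore.subgroupOf D :=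
    map_le_iff_le_comap.mp (hPL.trans inf_le_right)
  refine hDM ?_
  calc D = (⊤ : Subgroup D).map D.subtype := by rw [← MonoidHom.range_eq_map, range_subtype]
    _ = (normalizer ((P : Subgroup D) : Set D)).map D.subtype ⊔
        (M.normalCore.subgroupOf D).map D.subtype := by
      rw [← Subgroup.map_sup, ← Sylow.normalizer_sup_eq_top' P hPE]
      rfl
    _ ≤ M := sup_le ((le_normalizer_map D.subtype).trans hNM)
      (map_le_iff_le_comap.mpr (comap_mono (normalCore_le M)))

/-- In a finite supersoluble group, the order of the group induced on a chief factor divides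
every exponent of that group. -/
theorem IsSupersoluble.index_chiefCentralizer_dvd [Finite G] (hG : IsSupersoluble G)
    {H K : Subgroup G} (hc : IsChiefFactor H K) {n : ℕ}
    (hn : ∀ g : G, g ^ n ∈ chiefCentralizer H K hc.1) :
    (chiefCentralizer H K hc.1).index ∣ n := by
  have := hc.1
  have hcyc := hG.isCyclic_chiefFactor hc
  have hp := hG.prime_card_chiefFactor hc
  have hnorm := hc.2.1.map (QuotientGroup.mk' K) (QuotientGroup.mk'_surjective K)
  set N := H.map (QuotientGroup.mk' K) with hN
  let f : G →* MulAut N := MulAut.conjNormal.comp (QuotientGroup.mk' K)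
  have hker : f.ker = chiefCentralizer H K hc.1 := by
    ext g
    rw [chiefCentralizer, mem_comap, mem_centralizer_iff, MonoidHom.mem_ker, MulEquiv.ext_iff,
      ← hN, Subtype.forall]
    refine forall₂_congr fun x hx => ?_
    rw [Subtype.ext_iff]
    change QuotientGroup.mk' K g * x * (QuotientGroup.mk' K g)⁻¹ = x ↔ _
    rw [mul_inv_eq_iff_eq_mul, eq_comm]
  have hunits : IsCyclic (ZMod (Nat.card N))ˣ := ZMod.isCyclic_units_prime hp
  have hcycAut : IsCyclic (MulAut N) :=
    isCyclic_of_injective (IsCyclic.mulAutMulEquiv N).toMonoidHom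
      (IsCyclic.mulAutMulEquiv N).injective
  rw [← hker, index_ker, ← IsCyclic.exponent_eq_card, Monoid.exponent_dvd_iff_forall_pow_eq_one]
  rintro ⟨_, g, rfl⟩
  have hg := hn g
  rw [← hker, MonoidHom.mem_ker, map_pow] at hg
  exact Subtype.ext hg

/-- Every finite nearly nilpotent group is strongly supersoluble. -/
theorem isStronglySupersoluble_of_isNearlyNilpotent
    {G : Type*} [Group G] [Finite G] (h : IsNearlyNilpotent G) :
    IsStronglySupersoluble G := by
  obtain ⟨hG, hnn⟩ := h
  refine ⟨hG, fun H K hc => ?_⟩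
  let n := ∏ p ∈ (Nat.card G).primeFactors, p
  let D : Subgroup G := ⨅ (A : Subgroup G) (B : Subgroup G) (hAB : IsChiefFactor A B)
    (_ : IsNonFrattini A B hAB.1), chiefCentralizer A B hAB.1
  have hDnormal : D.Normal :=
    normal_iInf_normal fun A => normal_iInf_normal fun B => normal_iInf_normal fun hAB =>
      normal_iInf_normal fun _ => chiefCentralizer_normal hAB.1 hAB.2.1
  have hD (A B : Subgroup G) (hAB : IsChiefFactor A B) (hnF : IsNonFrattini A B hAB.1) :
      D ≤ chiefCentralizer A B hAB.1 :=
    iInf_le_of_le A (iInf_le_of_le B (iInf_le_of_le hAB (iInf_le _ hnF)))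
  have hpow (g : G) : g ^ n ∈ D := by
    simp only [D, mem_iInf]
    intro A B hAB hnF
    have := chiefCentralizer_normal hAB.1 hAB.2.1
    obtain ⟨p, hp, hdvd⟩ := hnn A B hAB hnF
    have hindex : (chiefCentralizer A B hAB.1).index ∣ n := by
      rcases (Nat.dvd_prime hp).mp hdvd with h1 | h1
      · rw [h1]
        exact one_dvd n
      · rw [h1]
        exact Finset.dvd_prod_of_mem _
          (Nat.mem_primeFactors.mpr ⟨hp, h1 ▸ index_dvd_card _, Nat.card_pos.ne'⟩)
    obtain ⟨k, hk⟩ := hindex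
    rw [hk, pow_mul]
    exact pow_mem (pow_index_mem _ g) k
  have hnil := isNilpotent_of_le_chiefCentralizer hD
  have hn : Squarefree n := by
    simp only [n, ← Nat.radical_eq_prod_primeFactors]
    exact UniqueFactorizationMonoid.squarefree_radical
  exact hn.squarefree_of_dvd
    (hG.index_chiefCentralizer_dvd hc fun g => hc.le_chiefCentralizer (hpow g))
end

section
/- Every quotient group (homomorphic image) of a finite nearly nilpotent group is nearly nilpotent. -/
open Subgroup Pointwise

variable {G : Type*} [Group G]

theorem mem_chiefCentralizer_iff_s6 {A B : Subgroup G} (hB : B.Normal) {g : G} :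
    g ∈ chiefCentralizer A B hB ↔ ∀ a ∈ A, (a * g)⁻¹ * (g * a) ∈ B := by
  simp only [chiefCentralizer, Subgroup.mem_comap, Subgroup.mem_centralizer_iff, Subgroup.coe_map,
    Set.forall_mem_image, SetLike.mem_coe, QuotientGroup.mk'_apply, ← QuotientGroup.mk_mul,
    QuotientGroup.eq]

theorem isNonFrattini_iff {A B : Subgroup G} (hB : B.Normal) :
    IsNonFrattini A B hB ↔ ∃ M : Subgroup G, IsCoatom M ∧ B ≤ M ∧ ¬ A ≤ M := by
  have hs : Function.Surjective (QuotientGroup.mk' B) := QuotientGroup.mk'_surjective B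
  rw [IsNonFrattini, frattini, Order.radical]
  simp only [le_iInf_iff, Set.mem_ofPred_eq, not_forall, exists_prop]
  constructor
  · rintro ⟨M, hM, hAM⟩
    refine ⟨M.comap (QuotientGroup.mk' B), Subgroup.isCoatom_comap_of_surjective hs hM, ?_, ?_⟩
    · exact QuotientGroup.le_comap_mk' B M
    · rwa [← Subgroup.map_le_iff_le_comap]
  · rintro ⟨M, hM, hBM, hAM⟩
    have hcm : (M.map (QuotientGroup.mk' B)).comap (QuotientGroup.mk' B) = M :=
      Subgroup.comap_map_eq_self (by rwa [QuotientGroup.ker_mk'])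
    refine ⟨M.map (QuotientGroup.mk' B), ?_, ?_⟩
    · have hinj := Subgroup.comap_injective hs
      refine ⟨fun htop => hM.1 (by rw [← hcm, htop, Subgroup.comap_top]), fun L hL => hinj ?_⟩
      rw [Subgroup.comap_top]
      apply hM.2
      rwa [← hcm, Subgroup.comap_lt_comap_of_surjective hs]
    · rwa [Subgroup.map_le_iff_le_comap, hcm]

theorem IsSupersoluble.of_surjective {H : Type*} [Group H] {f : G →* H}
    (hf : Function.Surjective f) (h : IsSupersoluble G) : IsSupersoluble H := by
  obtain ⟨n, s, hn, h0, hl, hs⟩ := h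
  refine ⟨n, fun i => (s i).map f, fun i => (hn i).map f hf, by simp [h0], ?_, fun i => ⟨?_, ?_⟩⟩
  · simp only [hl]
    exact Subgroup.map_top_of_surjective f hf
  · exact Subgroup.map_mono (hs i).1
  · have := hn i.castSucc
    have : ((s i.castSucc).map f).Normal := (hn i.castSucc).map f hf
    have := (hs i).2
    let q : G ⧸ s i.castSucc →* H ⧸ (s i.castSucc).map f :=
      QuotientGroup.map _ _ f (Subgroup.le_comap_map f _)
    have hq : ((s i.succ).map (QuotientGroup.mk' (s i.castSucc))).map q =
        ((s i.succ).map f).map (QuotientGroup.mk' ((s i.castSucc).map f)) := by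
      rw [Subgroup.map_map, Subgroup.map_map]
      rfl
    rw [← hq]
    exact isCyclic_of_surjective _ (q.subgroupMap_surjective _)

theorem IsChiefFactor.comap {H : Type*} [Group H] {f : G →* H} (hf : Function.Surjective f)
    {A B : Subgroup H} (h : IsChiefFactor A B) : IsChiefFactor (A.comap f) (B.comap f) := by
  obtain ⟨hB, hA, hlt, hmin⟩ := h
  refine ⟨hB.comap f, hA.comap f, (Subgroup.comap_lt_comap_of_surjective hf).mpr hlt, ?_⟩
  intro N hN hBN hNA
  have hcm : (N.map f).comap f = N :=
    Subgroup.comap_map_eq_self ((f.ker_le_comap B).trans hBN.le)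
  rw [← hcm, Subgroup.comap_lt_comap_of_surjective hf] at hBN
  rw [← hcm, hmin _ (hN.map f hf) hBN (Subgroup.map_le_iff_le_comap.mpr hNA)]

theorem IsNonFrattini.comap {H : Type*} [Group H] {f : G →* H} (hf : Function.Surjective f)
    {A B : Subgroup H} {hB : B.Normal} (h : IsNonFrattini A B hB) :
    IsNonFrattini (A.comap f) (B.comap f) (hB.comap f) := by
  obtain ⟨M, hM, hBM, hAM⟩ := (isNonFrattini_iff hB).mp h
  exact (isNonFrattini_iff _).mpr ⟨M.comap f, Subgroup.isCoatom_comap_of_surjective hf hM,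
    Subgroup.comap_mono hBM, mt (Subgroup.comap_le_comap_of_surjective hf).mp hAM⟩

theorem chiefCentralizer_comap {H : Type*} [Group H] {f : G →* H} (hf : Function.Surjective f)
    (A B : Subgroup H) (hB : B.Normal) :
    chiefCentralizer (A.comap f) (B.comap f) (hB.comap f) = (chiefCentralizer A B hB).comap f := by
  ext g
  rw [Subgroup.mem_comap, mem_chiefCentralizer_iff_s6, mem_chiefCentralizer_iff_s6, hf.forall]
  simp only [Subgroup.mem_comap, map_mul, map_inv]

/-- Every homomorphic image of a finite nearly nilpotent group is nearly nilpotent. -/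
theorem isNearlyNilpotent_of_surjective
    {G : Type*} [Group G] [Finite G] {H : Type*} [Group H] (f : G →* H)
    (hf : Function.Surjective f) (h : IsNearlyNilpotent G) :
    IsNearlyNilpotent H := by
  refine ⟨h.1.of_surjective hf, fun A B hc hnf => ?_⟩
  obtain ⟨p, hp, hdvd⟩ := h.2 _ _ (hc.comap hf) (hnf.comap hf)
  rw [chiefCentralizer_comap hf A B hc.1, Subgroup.index_comap_of_surjective _ hf] at hdvd
  exact ⟨p, hp, hdvd⟩
end
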